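/- arXiv:math/0701346 — 2 statements merged into one kernel-verified Lean document; each statement's English description precedes it below -/
import Mathlib

section
/- Let W be an irreducible graphon with ‖T_W‖ > 1. Then ρ(W) ≥ (‖T_W‖ − 1)/‖W‖_∞. -/
open MeasureTheory Filter Topology

noncomputable section

namespace Percolation

/-- The symmetrized lift of a two-variable real function to `Sym2`. If `f` is symmetric,
`sym2Val f s(a, b) = f a b`. -/
def sym2Val {α : Type*} (f : α → α → ℝ) : Sym2 α → ℝ :=
  Sym2.lift ⟨fun a b => (f a b + f b a) / 2, fun a b => by simp [add_comm]⟩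

/-- The product over the edges of `F` of a symmetric function of the endpoints. -/
def edgeProd {k : ℕ} (F : SimpleGraph (Fin k)) (f : Fin k → Fin k → ℝ) : ℝ := by
  classical exact ∏ e ∈ F.edgeFinset, sym2Val f e

/-- The homomorphism density `t(F, G)` of a finite simple graph `F` in the weighted graph
on `[n]` with edge weights `β`. -/
def homDensityG {n k : ℕ} (β : Fin n → Fin n → ℝ) (F : SimpleGraph (Fin k)) : ℝ :=
  (∑ v : Fin k → Fin n, edgeProd F fun i j => β (v i) (v j)) / (n : ℝ) ^ k

/-- The unit interval `[0,1] ⊆ ℝ`. -/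
def I01 : Set ℝ := Set.Icc 0 1

/-- The homomorphism density `t(F, W)` of a finite simple graph `F` in a graphon `W`. -/
def homDensityW {k : ℕ} (W : ℝ → ℝ → ℝ) (F : SimpleGraph (Fin k)) : ℝ :=
  ∫ x : Fin k → ℝ in Set.univ.pi fun _ => I01, edgeProd F fun i j => W (x i) (x j)

/-- `G_n → W`: convergence of the homomorphism densities for every finite simple graph. -/
def ConvergesTo (β : ∀ n : ℕ, Fin n → Fin n → ℝ) (W : ℝ → ℝ → ℝ) : Prop :=
  ∀ (k : ℕ) (F : SimpleGraph (Fin k)),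
    Tendsto (fun n => homDensityG (β n) F) atTop (nhds (homDensityW W F))

/-- `W` is a graphon: a bounded symmetric measurable function with nonnegative values. -/
def IsGraphon (W : ℝ → ℝ → ℝ) : Prop :=
  Measurable (Function.uncurry W) ∧ (∀ x y, 0 ≤ W x y) ∧ (∀ x y, W x y = W y x) ∧
    ∃ M : ℝ, ∀ x y, W x y ≤ M

/-- The Bernoulli measure on `Bool` with success probability `p`. -/
def bern (p : ℝ) : Measure Bool :=
  ENNReal.ofReal p • Measure.dirac true + ENNReal.ofReal (1 - p) • Measure.dirac false

/-- The law of the random graph in which each pair `{v, w}` is an edge independently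
with probability `min (p * β v w) 1`; a point of the sample space records for each
unordered pair whether it is an edge. -/
def percMeasure {V : Type*} [Fintype V] [DecidableEq V] (β : V → V → ℝ) (p : ℝ) :
    Measure (Sym2 V → Bool) :=
  Measure.pi fun e => bern (min (p * sym2Val β e) 1)

/-- The simple graph determined by a point of the sample space. -/
def graphOf {V : Type*} (ω : Sym2 V → Bool) : SimpleGraph V :=
  SimpleGraph.fromRel fun i j => ω s(i, j)

/-- The number of vertices of the component of `v` in `G`. -/
def compSize {V : Type*} (G : SimpleGraph V) (v : V) : ℕ := {w | G.Reachable v w}.ncard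

/-- The number of vertices of the largest component of `G`. -/
def C1 {V : Type*} [Fintype V] (G : SimpleGraph V) : ℕ :=
  Finset.univ.sup fun v => compSize G v

/-- The number of vertices of the second largest component of `G` (zero if `G` is
connected): the largest value of `min (|C_v|, |C_w|)` over vertices `v`, `w` lying in
distinct components. -/
def C2 {V : Type*} (G : SimpleGraph V) : ℕ :=
  sSup {m | ∃ v w : V, ¬G.Reachable v w ∧ m = min (compSize G v) (compSize G w)}

/-- The operator `T_W` with kernel `W` applied to `f`. -/
def applyT (W : ℝ → ℝ → ℝ) (f : ℝ → ℝ) (x : ℝ) : ℝ := ∫ y in I01, W x y * f y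

/-- The `L²[0,1]` norm of a function. -/
def l2norm (f : ℝ → ℝ) : ℝ := Real.sqrt (∫ x in I01, f x ^ 2)

/-- The `L²`-operator norm `‖T_W‖` of the integral operator with kernel `W`. -/
def opNorm (W : ℝ → ℝ → ℝ) : ℝ :=
  sSup {r | ∃ f : ℝ → ℝ, Measurable f ∧
    MeasureTheory.IntegrableOn (fun x => f x ^ 2) I01 ∧
    l2norm f ≤ 1 ∧ r = l2norm (applyT W f)}

/-- The survival probability `ρ(W)` of the multitype Poisson branching process with
kernel `W`: the supremum of `∫ f` over measurable `f : [0,1] → [0,1]` satisfying the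
functional equation `f(x) = 1 - exp(-∫ W(x,y) f(y) dy)` almost everywhere. -/
def survival (W : ℝ → ℝ → ℝ) : ℝ :=
  sSup {r | ∃ f : ℝ → ℝ, Measurable f ∧ (∀ x, f x ∈ Set.Icc (0 : ℝ) 1) ∧
    (∀ᵐ x ∂volume.restrict I01, f x = 1 - Real.exp (-∫ y in I01, W x y * f y)) ∧
    r = ∫ x in I01, f x}

/-- A graphon `W` is irreducible if there is no measurable `A ⊆ [0,1]` with
`0 < μ(A) < 1` such that `W = 0` a.e. on `A × ([0,1] \ A)`. -/
def Irreducible (W : ℝ → ℝ → ℝ) : Prop :=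
  ¬∃ A : Set ℝ, MeasurableSet A ∧ A ⊆ I01 ∧ 0 < volume A ∧ volume A < 1 ∧
    ∀ᵐ p : ℝ × ℝ, p.1 ∈ A → p.2 ∈ I01 \ A → W p.1 p.2 = 0

end Percolation
namespace Percolation

open MeasureTheory

/-- `‖W‖_∞`: the essential supremum of a (nonnegative) kernel `W` on `[0,1]²`. -/
def supNorm (W : ℝ → ℝ → ℝ) : ℝ :=
  (essSup (fun p : ℝ × ℝ => ENNReal.ofReal (W p.1 p.2))
    (volume.restrict (I01 ×ˢ I01))).toReal

end Percolation

namespace Percolation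

open MeasureTheory Filter Topology
open scoped ENNReal

theorem schur_aux {ν : Measure ℝ} [SFinite ν] {K : ℝ → ℝ → ℝ≥0∞}
    (hK : Measurable (Function.uncurry K)) (hsymm : ∀ x y, K x y = K y x)
    {p g : ℝ → ℝ≥0∞} (hp : Measurable p) (hg : Measurable g) (hpt : ∀ x, p x ≠ ⊤)
    {c : ℝ≥0∞} (hc : ∀ᵐ x ∂ν, ∫⁻ y, K x y * p y ∂ν ≤ c * p x)
    (hz : ∀ᵐ x ∂ν, ∀ᵐ y ∂ν, p y = 0 → K x y = 0) :
    ∫⁻ x, (∫⁻ y, K x y * g y ∂ν) ^ 2 ∂ν ≤ c ^ 2 * ∫⁻ x, g x ^ 2 ∂ν := by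
  have hKx : ∀ x, Measurable (K x) := fun x => hK.of_uncurry_left
  have hKy : ∀ y, Measurable (fun x => K x y) := fun y => hK.of_uncurry_right
  have hK' : Measurable (fun z : ℝ × ℝ => K z.1 z.2) := hK
  have step1 : ∀ᵐ x ∂ν, (∫⁻ y, K x y * g y ∂ν) ^ 2 ≤
      (c * p x) * ∫⁻ y, K x y * (g y ^ 2 / p y) ∂ν := by
    filter_upwards [hc, hz] with x hx hzx
    have h1 : ∫⁻ y, K x y * g y ∂ν ≤
        (∫⁻ y, K x y * p y ∂ν) ^ (1/2 : ℝ) *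
          (∫⁻ y, K x y * (g y ^ 2 / p y) ∂ν) ^ (1/2 : ℝ) := by
      refine le_trans ?_ (ENNReal.lintegral_mul_norm_pow_le
        (((hKx x).mul hp).aemeasurable)
        (((hKx x).mul ((hg.pow_const 2).div hp)).aemeasurable)
        (by norm_num) (by norm_num) (by norm_num))
      refine lintegral_mono_ae ?_
      filter_upwards [hzx] with y hy
      by_cases h0 : p y = 0
      · simp [hy h0]
      · rw [← ENNReal.mul_rpow_of_nonneg _ _ (by norm_num)]
        have : K x y * p y * (K x y * (g y ^ 2 / p y)) = (K x y * g y) ^ 2 := by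
          calc _ = K x y ^ 2 * (p y * (g y ^ 2 / p y)) := by ring
            _ = _ := by rw [ENNReal.mul_div_cancel h0 (hpt y)]; ring
        simp only [Pi.mul_apply, Pi.div_apply, this]
        rw [← ENNReal.rpow_natCast, ← ENNReal.rpow_mul]
        norm_num
    calc (∫⁻ y, K x y * g y ∂ν) ^ 2 ≤ ((∫⁻ y, K x y * p y ∂ν) ^ (1/2 : ℝ) *
          (∫⁻ y, K x y * (g y ^ 2 / p y) ∂ν) ^ (1/2 : ℝ)) ^ 2 := pow_le_pow_left' h1 2
      _ = (∫⁻ y, K x y * p y ∂ν) * (∫⁻ y, K x y * (g y ^ 2 / p y) ∂ν) := by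
        rw [mul_pow, ← ENNReal.rpow_natCast, ← ENNReal.rpow_natCast, ← ENNReal.rpow_mul,
          ← ENNReal.rpow_mul]
        norm_num
      _ ≤ _ := by gcongr
  calc ∫⁻ x, (∫⁻ y, K x y * g y ∂ν) ^ 2 ∂ν
      ≤ ∫⁻ x, (c * p x) * ∫⁻ y, K x y * (g y ^ 2 / p y) ∂ν ∂ν := lintegral_mono_ae step1
    _ = ∫⁻ x, ∫⁻ y, (c * p x) * (K x y * (g y ^ 2 / p y)) ∂ν ∂ν := by
        refine lintegral_congr fun x => ?_
        rw [lintegral_const_mul]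
        exact (hKx x).mul ((hg.pow_const 2).div hp)
    _ = ∫⁻ y, ∫⁻ x, (c * p x) * (K x y * (g y ^ 2 / p y)) ∂ν ∂ν := by
        refine lintegral_lintegral_swap (Measurable.aemeasurable ?_)
        have : Measurable (fun z : ℝ × ℝ => g z.2 ^ 2 / p z.2) :=
          ((hg.comp measurable_snd).pow_const 2).div (hp.comp measurable_snd)
        exact ((hp.comp measurable_fst).const_mul c).mul (hK'.mul this)
    _ = ∫⁻ y, (c * (g y ^ 2 / p y)) * ∫⁻ x, K y x * p x ∂ν ∂ν := by
        refine lintegral_congr fun y => ?_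
        rw [← lintegral_const_mul (f := fun x => K y x * p x) _ ((hKx y).mul hp)]
        refine lintegral_congr fun x => ?_
        rw [hsymm y x]; ring
    _ ≤ ∫⁻ y, c ^ 2 * g y ^ 2 ∂ν := by
        refine lintegral_mono_ae ?_
        filter_upwards [hc] with y hy
        calc _ ≤ (c * (g y ^ 2 / p y)) * (c * p y) := by gcongr
          _ = c ^ 2 * (p y * (g y ^ 2 / p y)) := by ring
          _ ≤ _ := by gcongr; exact ENNReal.mul_div_le
    _ = _ := lintegral_const_mul _ (hg.pow_const 2)

def iterF (W : ℝ → ℝ → ℝ) : ℕ → ℝ → ℝ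
  | 0 => fun _ => 1
  | k + 1 => fun x => 1 - Real.exp (-∫ y in I01, W x y * iterF W k y)

instance : IsProbabilityMeasure (volume.restrict I01) := ⟨by simp [I01]⟩

section
variable {W : ℝ → ℝ → ℝ} (hW : IsGraphon W)

theorem meas_applyT (hm : Measurable (Function.uncurry W)) {f : ℝ → ℝ} (hf : Measurable f) :
    Measurable (fun x => ∫ y in I01, W x y * f y) := by
  have h : Measurable (fun z : ℝ × ℝ => W z.1 z.2 * f z.2) :=
    Measurable.mul hm (hf.comp measurable_snd)
  exact (h.stronglyMeasurable.integral_prod_right' (ν := volume.restrict I01)).measurable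

theorem integrable_row (hW : IsGraphon W) {f : ℝ → ℝ} (hf : Measurable f)
    (hf1 : ∀ x, f x ∈ Set.Icc (0:ℝ) 1) (x : ℝ) :
    Integrable (fun y => W x y * f y) (volume.restrict I01) := by
  obtain ⟨hm, h0, hs, M, hM⟩ := hW
  have hx : Measurable (W x) := hm.of_uncurry_left
  refine Integrable.of_bound (hx.mul hf).aestronglyMeasurable M (ae_of_all _ fun y => ?_)
  rw [Real.norm_of_nonneg (mul_nonneg (h0 _ _) (hf1 y).1)]
  nlinarith [hM x y, h0 x y, (hf1 y).1, (hf1 y).2]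

theorem iterF_meas (hW : IsGraphon W) (k : ℕ) : Measurable (iterF W k) := by
  induction k with
  | zero => exact measurable_const
  | succ k ih =>
    exact measurable_const.sub (Real.measurable_exp.comp (meas_applyT hW.1 ih).neg)

theorem iterF_mem (hW : IsGraphon W) (k : ℕ) : ∀ x, iterF W k x ∈ Set.Icc (0:ℝ) 1 := by
  induction k with
  | zero => intro x; simp [iterF]
  | succ k ih =>
    intro x
    have h : 0 ≤ ∫ y in I01, W x y * iterF W k y :=
      integral_nonneg fun y => mul_nonneg (hW.2.1 _ _) (ih y).1
    have h2 := Real.exp_le_one_iff.2 (neg_nonpos.2 h)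
    have h3 := Real.exp_pos (-∫ y in I01, W x y * iterF W k y)
    simp only [iterF, Set.mem_Icc]
    constructor <;> linarith

theorem iterF_succ_le (hW : IsGraphon W) (k : ℕ) : ∀ x, iterF W (k+1) x ≤ iterF W k x := by
  induction k with
  | zero => intro x; exact (iterF_mem hW 1 x).2
  | succ k ih =>
    intro x
    have : ∫ y in I01, W x y * iterF W (k+1) y ≤ ∫ y in I01, W x y * iterF W k y :=
      integral_mono (integrable_row hW (iterF_meas hW _) (iterF_mem hW _) x)
        (integrable_row hW (iterF_meas hW _) (iterF_mem hW _) x)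
        fun y => mul_le_mul_of_nonneg_left (ih y) (hW.2.1 _ _)
    have h2 := Real.exp_le_exp.2 (neg_le_neg this)
    change 1 - Real.exp _ ≤ 1 - Real.exp _
    linarith

theorem iterF_zero (hW : IsGraphon W) (k : ℕ) :
    ∀ᵐ x ∂volume.restrict I01, ∀ᵐ y ∂volume.restrict I01, iterF W k y = 0 → W x y = 0 := by
  induction k with
  | zero => simp [iterF]
  | succ k ih =>
    rw [Measure.ae_ae_comm]
    · filter_upwards [ih] with y hy
      by_cases h : iterF W (k+1) y = 0
      · have h1 : ∫ z in I01, W y z * iterF W k z = 0 := by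
          have h' : 1 - Real.exp (-∫ z in I01, W y z * iterF W k z) = 0 := h
          have h'' : Real.exp (-∫ z in I01, W y z * iterF W k z) = 1 := by linarith
          have := (Real.exp_eq_one_iff _).1 h''
          linarith
        rw [integral_eq_zero_iff_of_nonneg
          (fun z => mul_nonneg (hW.2.1 _ _) (iterF_mem hW k z).1)
          (integrable_row hW (iterF_meas hW _) (iterF_mem hW _) y)] at h1
        filter_upwards [h1, hy] with z hz1 hz2 _
        rw [hW.2.2.1]
        rcases mul_eq_zero.1 hz1 with h | h
        · exact h
        · exact hz2 h
      · exact ae_of_all _ fun _ h' => absurd h' h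
    · have h1 : MeasurableSet {z : ℝ × ℝ | iterF W (k+1) z.2 = 0} :=
        ((iterF_meas hW (k+1)).comp measurable_snd) (measurableSet_singleton 0)
      have h2 : MeasurableSet {z : ℝ × ℝ | W z.1 z.2 = 0} :=
        hW.1 (measurableSet_singleton 0)
      have : {z : ℝ × ℝ | iterF W (k+1) z.2 = 0 → W z.1 z.2 = 0} =
        {z : ℝ × ℝ | iterF W (k+1) z.2 = 0}ᶜ ∪ {z : ℝ × ℝ | W z.1 z.2 = 0} := by
        ext z; simp [imp_iff_not_or]
      rw [this]
      exact h1.compl.union h2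

theorem le_supNorm (hW : IsGraphon W) :
    ∀ᵐ x ∂volume.restrict I01, ∀ᵐ y ∂volume.restrict I01, W x y ≤ supNorm W := by
  obtain ⟨hm, h0, hs, M, hM⟩ := hW
  have h := ENNReal.ae_le_essSup (μ := volume.restrict (I01 ×ˢ I01))
    (fun p : ℝ × ℝ => ENNReal.ofReal (W p.1 p.2))
  have hfin : essSup (fun p : ℝ × ℝ => ENNReal.ofReal (W p.1 p.2))
      (volume.restrict (I01 ×ˢ I01)) ≠ ⊤ := by
    refine ne_top_of_le_ne_top (b := ENNReal.ofReal M) ENNReal.ofReal_ne_top ?_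
    exact essSup_le_of_ae_le _ (ae_of_all _ fun p => ENNReal.ofReal_le_ofReal (hM _ _))
  have h2 : ∀ᵐ p ∂((volume.restrict I01).prod (volume.restrict I01)),
      W (p : ℝ × ℝ).1 p.2 ≤ supNorm W := by
    rw [Measure.prod_restrict]
    filter_upwards [h] with p hp
    exact (ENNReal.ofReal_le_iff_le_toReal hfin).1 hp
  exact Measure.ae_ae_of_ae_prod h2

theorem T_le (hW : IsGraphon W) (k : ℕ) :
    ∀ᵐ x ∂volume.restrict I01, ∫ y in I01, W x y * iterF W k y ≤
      (1 + supNorm W * ∫ y in I01, iterF W k y) * iterF W k x := by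
  filter_upwards [le_supNorm hW] with x hx
  set u := ∫ y in I01, W x y * iterF W k y with hu
  have hi : Integrable (iterF W k) (volume.restrict I01) :=
    Integrable.of_bound (iterF_meas hW k).aestronglyMeasurable 1 (ae_of_all _ fun y => by
      rw [Real.norm_of_nonneg (iterF_mem hW k y).1]; exact (iterF_mem hW k y).2)
  have hu0 : 0 ≤ u := integral_nonneg fun y => mul_nonneg (hW.2.1 _ _) (iterF_mem hW k y).1
  have hule : u ≤ supNorm W * ∫ y in I01, iterF W k y := by
    rw [← integral_const_mul]
    refine integral_mono_ae (integrable_row hW (iterF_meas hW _) (iterF_mem hW _) x)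
      (hi.const_mul _) ?_
    filter_upwards [hx] with y hy
    exact mul_le_mul_of_nonneg_right hy (iterF_mem hW k y).1
  have h1 : 1 - Real.exp (-u) ≤ iterF W k x := iterF_succ_le hW k x
  have h2 : u ≤ (1 + u) * (1 - Real.exp (-u)) := by
    have h3 := Real.add_one_le_exp u
    have h4 : Real.exp u * Real.exp (-u) = 1 := by rw [← Real.exp_add]; simp
    nlinarith [Real.exp_pos (-u)]
  calc u ≤ _ := h2
    _ ≤ (1 + u) * iterF W k x := by gcongr
    _ ≤ _ := by
      have := (iterF_mem hW k x).1
      gcongr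

theorem opNorm_le (hW : IsGraphon W) (k : ℕ) :
    opNorm W ≤ 1 + supNorm W * ∫ y in I01, iterF W k y := by
  set c := 1 + supNorm W * ∫ y in I01, iterF W k y with hcdef
  have hc0 : 0 ≤ c := by
    have : 0 ≤ ∫ y in I01, iterF W k y := integral_nonneg fun y => (iterF_mem hW k y).1
    have h2 : 0 ≤ supNorm W := ENNReal.toReal_nonneg
    positivity
  refine Real.sSup_le ?_ hc0
  rintro r ⟨f, hf, hfi, hf1, rfl⟩
  have hS := schur_aux (ν := volume.restrict I01) (K := fun x y => ENNReal.ofReal (W x y))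
    (p := fun x => ENNReal.ofReal (iterF W k x)) (g := fun x => ‖f x‖ₑ)
    (c := ENNReal.ofReal c) (ENNReal.measurable_ofReal.comp hW.1)
    (fun x y => by rw [hW.2.2.1]) (iterF_meas hW k).ennreal_ofReal hf.enorm
    (fun x => ENNReal.ofReal_ne_top)
    (by
      filter_upwards [T_le hW k] with x hx
      rw [← ENNReal.ofReal_mul hc0]
      refine le_trans (le_of_eq ?_) (ENNReal.ofReal_le_ofReal hx)
      rw [ofReal_integral_eq_lintegral_ofReal
        (integrable_row hW (iterF_meas hW _) (iterF_mem hW _) x)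
        (ae_of_all _ fun y => mul_nonneg (hW.2.1 _ _) (iterF_mem hW k y).1)]
      exact lintegral_congr fun y => (ENNReal.ofReal_mul (hW.2.1 _ _)).symm)
    (by
      filter_upwards [iterF_zero hW k] with x hx
      filter_upwards [hx] with y hy h0
      rw [hy (le_antisymm (ENNReal.ofReal_eq_zero.1 h0) (iterF_mem hW k y).1)]
      simp)
  have sq : ∀ a : ℝ, ENNReal.ofReal (a ^ 2) = ‖a‖ₑ ^ 2 := fun a => by
    rw [← sq_abs, ENNReal.ofReal_pow (abs_nonneg _), ← Real.norm_eq_abs, ofReal_norm]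
  have hg1 : ∫⁻ x in I01, ‖f x‖ₑ ^ 2 ≤ 1 := by
    have h1 : ∫ x in I01, f x ^ 2 ≤ 1 := by
      have := (Real.sqrt_le_left zero_le_one).1 hf1
      simpa using this
    simp_rw [← sq]
    rw [← ofReal_integral_eq_lintegral_ofReal hfi (ae_of_all _ fun y => sq_nonneg _)]
    exact ENNReal.ofReal_le_one.2 h1
  unfold l2norm
  rw [Real.sqrt_le_left hc0]
  have hT : Measurable (applyT W f) := meas_applyT hW.1 hf
  rw [integral_eq_lintegral_of_nonneg_ae (ae_of_all _ fun y => sq_nonneg _)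
    (hT.pow_const 2).aestronglyMeasurable]
  refine ENNReal.toReal_le_of_le_ofReal (by positivity) ?_
  calc ∫⁻ x in I01, ENNReal.ofReal (applyT W f x ^ 2)
      ≤ ∫⁻ x in I01, (∫⁻ y in I01, ENNReal.ofReal (W x y) * ‖f y‖ₑ) ^ 2 := by
        refine lintegral_mono fun x => ?_
        rw [sq]
        gcongr
        refine (enorm_integral_le_lintegral_enorm _).trans (le_of_eq ?_)
        refine lintegral_congr fun y => ?_
        rw [enorm_mul, Real.enorm_of_nonneg (hW.2.1 _ _)]
    _ ≤ _ := hS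
    _ ≤ ENNReal.ofReal c ^ 2 * 1 := by gcongr
    _ = _ := by rw [mul_one, ENNReal.ofReal_pow hc0]

end

end Percolation

open Percolation MeasureTheory Filter Topology in
/-- If `W` is an irreducible graphon with `‖T_W‖ > 1`, then
`ρ(W) ≥ (‖T_W‖ - 1)/‖W‖_∞`. -/
theorem survival_lower_bound
    (W : ℝ → ℝ → ℝ) (hW : IsGraphon W) (hirr : Percolation.Irreducible W)
    (hsup : 1 < opNorm W) :
    (opNorm W - 1) / supNorm W ≤ survival W := by
  have hanti : ∀ x, Antitone (fun k => iterF W k x) :=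
    fun x => antitone_nat_of_succ_le fun k => iterF_succ_le hW k x
  have hbdd : ∀ x, BddBelow (Set.range fun k => iterF W k x) :=
    fun x => ⟨0, by rintro _ ⟨k, rfl⟩; exact (iterF_mem hW k x).1⟩
  set f : ℝ → ℝ := fun x => ⨅ k, iterF W k x with hf
  have hlim : ∀ x, Tendsto (fun k => iterF W k x) atTop (𝓝 (f x)) :=
    fun x => tendsto_atTop_ciInf (hanti x) (hbdd x)
  have hfm : Measurable f :=
    measurable_of_tendsto_metrizable (iterF_meas hW) (tendsto_pi_nhds.2 hlim)
  have hf1 : ∀ x, f x ∈ Set.Icc (0:ℝ) 1 := fun x =>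
    isClosed_Icc.mem_of_tendsto (hlim x) (Eventually.of_forall fun k => iterF_mem hW k x)
  have hM := hW.2.2.2
  obtain ⟨M, hM⟩ := hM
  have hfix : ∀ x, f x = 1 - Real.exp (-∫ y in I01, W x y * f y) := by
    intro x
    have h1 : Tendsto (fun k => ∫ y in I01, W x y * iterF W k y) atTop
        (𝓝 (∫ y in I01, W x y * f y)) := by
      refine tendsto_integral_of_dominated_convergence (fun _ => M)
        (fun k => (integrable_row hW (iterF_meas hW k) (iterF_mem hW k) x).1)
        (integrable_const _) (fun k => ae_of_all _ fun y => ?_)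
        (ae_of_all _ fun y => (hlim y).const_mul _)
      rw [Real.norm_of_nonneg (mul_nonneg (hW.2.1 _ _) (iterF_mem hW k y).1)]
      nlinarith [hM x y, hW.2.1 x y, (iterF_mem hW k y).1, (iterF_mem hW k y).2]
    have h2 : Tendsto (fun k => iterF W (k+1) x) atTop
        (𝓝 (1 - Real.exp (-∫ y in I01, W x y * f y))) :=
      tendsto_const_nhds.sub ((Real.continuous_exp.tendsto _).comp h1.neg)
    exact tendsto_nhds_unique ((tendsto_add_atTop_iff_nat 1).2 (hlim x)) h2
  have hint : Tendsto (fun k => ∫ y in I01, iterF W k y) atTop (𝓝 (∫ y in I01, f y)) := by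
    refine tendsto_integral_of_dominated_convergence (fun _ => 1)
      (fun k => (iterF_meas hW k).aestronglyMeasurable)
      (integrable_const _) (fun k => ae_of_all _ fun y => ?_)
      (ae_of_all _ fun y => hlim y)
    rw [Real.norm_of_nonneg (iterF_mem hW k y).1]
    exact (iterF_mem hW k y).2
  have hle : opNorm W ≤ 1 + supNorm W * ∫ y in I01, f y :=
    ge_of_tendsto (tendsto_const_nhds.add (hint.const_mul _))
      (Eventually.of_forall fun k => opNorm_le hW k)
  have hS : ∫ y in I01, f y ≤ survival W := by
    refine le_csSup ⟨1, ?_⟩ ⟨f, hfm, hf1, ae_of_all _ hfix, rfl⟩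
    rintro r ⟨g, hg, hg1, -, rfl⟩
    have h := integral_mono_of_nonneg (μ := volume.restrict I01) (f := g) (g := fun _ => (1:ℝ))
      (ae_of_all _ fun y => (hg1 y).1) (integrable_const _) (ae_of_all _ fun y => (hg1 y).2)
    simpa using h
  have hf0 : 0 ≤ ∫ y in I01, f y := integral_nonneg fun y => (hf1 y).1
  have hs0 : 0 ≤ supNorm W := ENNReal.toReal_nonneg
  refine le_trans (div_le_of_le_mul₀ hs0 hf0 ?_) hS
  linarith
end
end

section
/- Let H be a random simple graph on a finite vertex set V in which each pair of vertices ij is an edge independently with some probability p_ij ∈ [0,1]. Fix vertices v, w ∈ V and an integer k ≥ 1, and let c(u) denote the number of vertices of the component of H containing u, and d(v,w) the graph distance between v and w in H (with d(v,w) = ∞ if they lie in different components). Then P(c(v) ≥ k and c(w) ≥ k) ≤ P(c(v) ≥ k)·P(c(w) ≥ k) + P(d(v,w) ≤ 2k). -/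
open MeasureTheory Filter Topology

noncomputable section

namespace Percolation

def gball {V : Type*} (G : SimpleGraph V) (u : V) : ℕ → Set V
  | 0 => {u}
  | n + 1 => {y | y ∈ gball G u n ∨ ∃ x ∈ gball G u n, G.Adj x y}

theorem gball_walk {V : Type*} (G : SimpleGraph V) (u : V) (n : ℕ) :
    ∀ y ∈ gball G u n, ∃ q : G.Walk u y, q.length ≤ n := by
  induction n with
  | zero =>
    intro y hy
    have : y = u := hy
    subst this
    exact ⟨SimpleGraph.Walk.nil, by simp⟩
  | succ n ih =>
    rintro y (hy | ⟨x, hx, hxy⟩)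
    · obtain ⟨q, hq⟩ := ih y hy
      exact ⟨q, by omega⟩
    · obtain ⟨q, hq⟩ := ih x hx
      exact ⟨q.concat hxy, by simp; omega⟩

theorem gball_mem_self {V : Type*} (G : SimpleGraph V) (u : V) (n : ℕ) : u ∈ gball G u n := by
  induction n with
  | zero => exact rfl
  | succ n ih => exact Or.inl ih

theorem gball_sub_succ {V : Type*} (G : SimpleGraph V) (u : V) (n : ℕ) :
    gball G u n ⊆ gball G u (n + 1) := fun _ h => Or.inl h

theorem gball_le_comp {V : Type*} [Finite V] (G : SimpleGraph V) (u : V) (n : ℕ) :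
    (gball G u n).ncard ≤ compSize G u := by
  refine Set.ncard_le_ncard ?_ (Set.toFinite _)
  intro y hy
  obtain ⟨q, -⟩ := gball_walk G u n y hy
  exact ⟨q⟩

theorem gball_grow {V : Type*} [Finite V] (G : SimpleGraph V) (u : V) (n : ℕ) :
    n + 1 ≤ (gball G u n).ncard ∨ {y | G.Reachable u y} ⊆ gball G u n := by
  induction n with
  | zero => left; simp [gball]
  | succ n ih =>
    rcases ih with ih | ih
    · by_cases h : gball G u (n + 1) ⊆ gball G u n
      · right
        refine Set.Subset.trans ?_ (gball_sub_succ G u n)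
        have key : ∀ a b : V, G.Walk a b → a ∈ gball G u n → b ∈ gball G u n := by
          intro a b q
          induction q with
          | nil => exact id
          | cons hab q ih2 => exact fun ha => ih2 (h (Or.inr ⟨_, ha, hab⟩))
        rintro y ⟨q⟩
        exact key _ _ q (gball_mem_self G u n)
      · left
        have : (gball G u n).ncard < (gball G u (n + 1)).ncard :=
          Set.ncard_lt_ncard ⟨gball_sub_succ G u n, h⟩ (Set.toFinite _)
        omega
    · right
      exact ih.trans (gball_sub_succ G u n)

theorem gball_comp_iff {V : Type*} [Finite V] (G : SimpleGraph V) (u : V) (k : ℕ) (hk : 1 ≤ k) :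
    k ≤ compSize G u ↔ k ≤ (gball G u (k - 1)).ncard := by
  constructor
  · intro h
    rcases gball_grow G u (k - 1) with h1 | h1
    · omega
    · exact h.trans (Set.ncard_le_ncard h1 (Set.toFinite _))
  · intro h
    exact h.trans (gball_le_comp G u _)

theorem gball_local {V : Type*} (G G' : SimpleGraph V) (u : V) (S : Set V)
    (hS : ∀ x ∈ S, ∀ y, G.Adj x y ↔ G'.Adj x y) (n : ℕ) (h : gball G u n ⊆ S) :
    gball G' u n = gball G u n := by
  induction n with
  | zero => rfl
  | succ n ih =>
    have h0 := (gball_sub_succ G u n).trans h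
    have e := ih h0
    ext y
    simp only [gball, e, Set.mem_setOf_eq]
    refine or_congr Iff.rfl (exists_congr fun x => and_congr_right fun hx => ?_)
    exact (hS x (h0 hx) y).symm

open Classical in
def maskOut {V : Type*} (S : Set V) (ω : Sym2 V → Bool) : Sym2 V → Bool :=
  fun e => if ∃ x ∈ S, x ∈ e then false else ω e

theorem graphOf_adj {V : Type*} (ω : Sym2 V → Bool) (x y : V) :
    (graphOf ω).Adj x y ↔ x ≠ y ∧ ω s(x, y) = true := by
  simp [graphOf, Sym2.eq_swap (a := y) (b := x)]

theorem maskOut_adj {V : Type*} (S : Set V) (ω : Sym2 V → Bool) (x y : V) :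
    (graphOf (maskOut S ω)).Adj x y ↔ (graphOf ω).Adj x y ∧ x ∉ S ∧ y ∉ S := by
  rw [graphOf_adj, graphOf_adj, maskOut]
  by_cases h : ∃ z ∈ S, z ∈ s(x, y)
  · rw [if_pos h]
    obtain ⟨z, hz, hzz⟩ := h
    rcases Sym2.mem_iff.1 hzz with rfl | rfl <;> simp [hz]
  · rw [if_neg h]
    have hx : x ∉ S := fun hx => h ⟨x, hx, Sym2.mem_mk_left x y⟩
    have hy : y ∉ S := fun hy => h ⟨y, hy, Sym2.mem_mk_right x y⟩
    simp [hx, hy]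

theorem maskOut_comp_le {V : Type*} [Finite V] (S : Set V) (ω : Sym2 V → Bool) (w : V) :
    compSize (graphOf (maskOut S ω)) w ≤ compSize (graphOf ω) w := by
  refine Set.ncard_le_ncard ?_ (Set.toFinite _)
  intro y hy
  exact SimpleGraph.Reachable.mono (fun a b h => ((maskOut_adj S ω a b).1 h).1) hy

theorem mask_key {V : Type*} [Finite V] (ω : Sym2 V → Bool) (v w : V) (k : ℕ) (hk : 1 ≤ k)
    (hw : k ≤ compSize (graphOf ω) w)
    (hd : ¬ ((graphOf ω).Reachable v w ∧ (graphOf ω).dist v w ≤ 2 * k)) :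
    k ≤ compSize (graphOf (maskOut (gball (graphOf ω) v (k - 1)) ω)) w := by
  rw [gball_comp_iff _ _ _ hk] at hw ⊢
  have far : ∀ q : (graphOf ω).Walk v w, ¬ q.length ≤ 2 * k := fun q hq =>
    hd ⟨⟨q⟩, (SimpleGraph.dist_le q).trans hq⟩
  rwa [gball_local (graphOf ω) _ w (gball (graphOf ω) w (k - 1)) _ (k - 1) subset_rfl]
  intro x hx y
  rw [maskOut_adj]
  constructor
  · intro hxy
    obtain ⟨q, hq⟩ := gball_walk _ _ _ x hx
    refine ⟨hxy, fun hxS => ?_, fun hyS => ?_⟩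
    · obtain ⟨r, hr⟩ := gball_walk _ _ _ x hxS
      apply far (r.append q.reverse)
      simp; omega
    · obtain ⟨r, hr⟩ := gball_walk _ _ _ y hyS
      apply far ((r.concat hxy.symm).append q.reverse)
      simp; omega
  · exact fun h => h.1

theorem bern_disc (p : ℝ) (h0 : 0 ≤ p) (h1 : p ≤ 1) : IsProbabilityMeasure (bern p) := by
  constructor
  simp [bern]
  rw [← ENNReal.ofReal_add h0 (by linarith)]
  simp

theorem pi_indep {E : Type*} [Fintype E] (m : E → Measure Bool) [∀ e, IsProbabilityMeasure (m e)]
    (S : Finset E) (A B : Set (E → Bool))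
    (hA : ∀ ω ω', (∀ e ∈ S, ω e = ω' e) → ω ∈ A → ω' ∈ A)
    (hB : ∀ ω ω', (∀ e, e ∉ S → ω e = ω' e) → ω ∈ B → ω' ∈ B) :
    Measure.pi m (A ∩ B) = Measure.pi m A * Measure.pi m B := by
  classical
  have hi : ProbabilityTheory.iIndepFun (fun (e : E) (ω : E → Bool) => ω e) (Measure.pi m) :=
    ProbabilityTheory.iIndepFun_pi (X := fun _ => id) (fun _ => aemeasurable_id)
  have hf := hi.indepFun_finset S Sᶜ disjoint_compl_right (fun e => measurable_pi_apply e)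
  have eA : A = (fun (ω : E → Bool) (i : S) => ω i) ⁻¹'
      ((fun (ω : E → Bool) (i : S) => ω i) '' A) := by
    refine (Set.subset_preimage_image _ _).antisymm ?_
    rintro ω' ⟨ω, hω, h⟩
    exact hA ω ω' (fun e he => congrFun h ⟨e, he⟩) hω
  have eB : B = (fun (ω : E → Bool) (i : (Sᶜ : Finset E)) => ω i) ⁻¹'
      ((fun (ω : E → Bool) (i : (Sᶜ : Finset E)) => ω i) '' B) := by
    refine (Set.subset_preimage_image _ _).antisymm ?_
    rintro ω' ⟨ω, hω, h⟩
    exact hB ω ω' (fun e he => congrFun h ⟨e, by simpa using he⟩) hω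
  rw [eA, eB]
  exact hf.measure_inter_preimage_eq_mul _ _ (Set.toFinite _).measurableSet
    (Set.toFinite _).measurableSet

end Percolation

open Percolation MeasureTheory Filter Topology in
/-- Let `H` be a random graph on a finite vertex set `V` whose edges
appear independently with probabilities `p_e`. For vertices `v, w` and `k ≥ 1`,
`P(c(v) ≥ k, c(w) ≥ k) ≤ P(c(v) ≥ k) P(c(w) ≥ k) + P(d(v,w) ≤ 2k)`, where `c(u)` is the
size of the component of `u` and the last event requires `v, w` to be in the same
component at graph distance at most `2k`. -/
theorem component_correlation_bound
    {V : Type*} [Fintype V] [DecidableEq V]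
    (p : Sym2 V → ℝ) (hp0 : ∀ e, 0 ≤ p e) (hp1 : ∀ e, p e ≤ 1)
    (v w : V) (k : ℕ) (hk : 1 ≤ k) :
    (Measure.pi fun e => bern (p e))
        {ω | k ≤ compSize (graphOf ω) v ∧ k ≤ compSize (graphOf ω) w} ≤
      (Measure.pi fun e => bern (p e)) {ω | k ≤ compSize (graphOf ω) v} *
        (Measure.pi fun e => bern (p e)) {ω | k ≤ compSize (graphOf ω) w} +
      (Measure.pi fun e => bern (p e))
        {ω | (graphOf ω).Reachable v w ∧ (graphOf ω).dist v w ≤ 2 * k} := by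
  classical
  haveI : ∀ e, IsProbabilityMeasure (bern (p e)) := fun e => bern_disc _ (hp0 e) (hp1 e)
  set μ := Measure.pi fun e => bern (p e) with hμ
  let f : (Sym2 V → Bool) → Set V := fun ω => gball (graphOf ω) v (k - 1)
  let F : Finset (Set V) := Finset.univ.filter fun S => k ≤ S.ncard
  have hsub : {ω | k ≤ compSize (graphOf ω) v ∧ k ≤ compSize (graphOf ω) w} ⊆
      (⋃ S ∈ F, (f ⁻¹' {S} ∩ {ω | k ≤ compSize (graphOf (maskOut S ω)) w})) ∪
      {ω | (graphOf ω).Reachable v w ∧ (graphOf ω).dist v w ≤ 2 * k} := by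
    rintro ω ⟨h1, h2⟩
    by_cases hd : (graphOf ω).Reachable v w ∧ (graphOf ω).dist v w ≤ 2 * k
    · exact Or.inr hd
    · left
      simp only [Set.mem_iUnion]
      refine ⟨f ω, ?_, rfl, mask_key ω v w k hk h2 hd⟩
      simpa [F] using (gball_comp_iff _ _ _ hk).1 h1
  refine (measure_mono hsub).trans ((measure_union_le _ _).trans ?_)
  gcongr
  refine (measure_biUnion_finset_le _ _).trans ?_
  have hterm : ∀ S ∈ F, μ (f ⁻¹' {S} ∩ {ω | k ≤ compSize (graphOf (maskOut S ω)) w}) ≤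
      μ (f ⁻¹' {S}) * μ {ω | k ≤ compSize (graphOf ω) w} := by
    intro S _
    rw [hμ, pi_indep _ (Finset.univ.filter fun e : Sym2 V => ∃ x ∈ S, x ∈ e)]
    · gcongr
      exact maskOut_comp_le S _ w
    · intro ω ω' h hω
      have hω : f ω = S := hω
      have : f ω' = f ω := by
        refine gball_local _ _ v S ?_ (k - 1) hω.le
        intro x hx y
        rw [graphOf_adj, graphOf_adj, h s(x, y)]
        simp only [Finset.mem_filter, Finset.mem_univ, true_and]
        exact ⟨x, hx, Sym2.mem_mk_left x y⟩
      exact this.trans hω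
    · intro ω ω' h hω
      have : maskOut S ω' = maskOut S ω := by
        funext e
        unfold maskOut
        split_ifs with he
        · rfl
        · exact (h e (by simpa using he)).symm
      simpa [this] using hω
  refine (Finset.sum_le_sum hterm).trans ?_
  rw [← Finset.sum_mul]
  gcongr
  rw [sum_measure_preimage_singleton F (fun S _ => (Set.toFinite _).measurableSet)]
  refine measure_mono ?_
  intro ω hω
  refine (gball_comp_iff _ _ _ hk).2 ?_
  simpa [F, f] using hω
end
end
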